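/- arXiv:math/0208084 — 4 statements merged into one kernel-verified Lean document; each statement's English description precedes it below -/
import Mathlib

section
/- Let N be a simple C*-algebra (a complex C*-algebra whose only closed two-sided ideals are {0} and N), and let A be a separable C*-subalgebra of N. Then there exists a C*-subalgebra B of N with A ⊆ B ⊆ N such that B is separable and B is simple as a C*-algebra in its own right (the only closed two-sided ideals of B are {0} and B). -/
/-- A (possibly non-unital) C*-algebra is *simple* if its only closed two-sided ideals
are the zero ideal and the whole algebra. -/
def IsSimpleCStarAlgebra (D : Type*) [NonUnitalCStarAlgebra D] : Prop :=
  ∀ I : TwoSidedIdeal D, IsClosed (I : Set D) → I = ⊥ ∨ I = ⊤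

/-- Every countable set is contained in a countable set that is closed under a given binary
operation with countable sets as values. -/
theorem Set.Countable.exists_countable_superset_forall_subset {α : Type*} {S : Set α}
    (hS : S.Countable) (Φ : α → α → Set α) (hΦ : ∀ x y, (Φ x y).Countable) :
    ∃ T : Set α, T.Countable ∧ S ⊆ T ∧ ∀ x ∈ T, ∀ y ∈ T, Φ x y ⊆ T := by
  let step : Set α → Set α := fun U ↦ U ∪ ⋃ x ∈ U, ⋃ y ∈ U, Φ x y
  have hstep (U : Set α) (hU : U.Countable) : (step U).Countable :=
    hU.union (hU.biUnion fun x _ ↦ hU.biUnion fun y _ ↦ hΦ x y)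
  let V : ℕ → Set α := fun n ↦ step^[n] S
  have hVsucc (n : ℕ) : V (n + 1) = step (V n) := Function.iterate_succ_apply' step n S
  have hVc (n : ℕ) : (V n).Countable := by
    induction n with
    | zero => exact hS
    | succ n ih => rw [hVsucc]; exact hstep _ ih
  have hVmono : Monotone V := monotone_nat_of_le_succ fun n ↦ by
    rw [hVsucc]; exact Set.subset_union_left
  refine ⟨⋃ n, V n, Set.countable_iUnion hVc, Set.subset_iUnion V 0, fun x hx y hy z hz ↦ ?_⟩
  obtain ⟨m, hm⟩ := Set.mem_iUnion.1 hx
  obtain ⟨n, hn⟩ := Set.mem_iUnion.1 hy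
  refine Set.mem_iUnion.2 ⟨max m n + 1, ?_⟩
  rw [hVsucc]
  refine Or.inr (Set.mem_iUnion₂.2 ⟨x, hVmono (le_max_left m n) hm, ?_⟩)
  exact Set.mem_iUnion₂.2 ⟨y, hVmono (le_max_right m n) hn, hz⟩

/-- If `u = y * κ * u` and `‖(y - x) * κ‖ < 1` for some `x` in a closed ideal, then `u` belongs to
the ideal. -/
theorem TwoSidedIdeal.mem_of_mul_mul_eq_of_norm_lt_one {R : Type*} [NonUnitalNormedRing R]
    (I : TwoSidedIdeal R) (hI : IsClosed (I : Set R)) {x y κ u : R} (hx : x ∈ I)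
    (hu : y * κ * u = u) (hlt : ‖(y - x) * κ‖ < 1) : u ∈ I := by
  set w := (y - x) * κ with hw
  have hsub (n : ℕ) : u - (w * ·)^[n] u ∈ I := by
    induction n with
    | zero => simp
    | succ n ih =>
      rw [Function.iterate_succ_apply']
      have h : u - w * (w * ·)^[n] u = x * κ * u + w * (u - (w * ·)^[n] u) := by
        have hwu : w * u = u - x * κ * u := by rw [hw, sub_mul, sub_mul, hu]
        rw [mul_sub, hwu]
        abel
      rw [h]
      exact I.add_mem (I.mul_mem_right _ _ (I.mul_mem_right _ _ hx)) (I.mul_mem_left _ _ ih)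
  have hnorm (n : ℕ) : ‖(w * ·)^[n] u‖ ≤ ‖w‖ ^ n * ‖u‖ := by
    induction n with
    | zero => simp
    | succ n ih =>
      rw [Function.iterate_succ_apply', pow_succ', mul_assoc ‖w‖]
      exact (norm_mul_le w _).trans (mul_le_mul_of_nonneg_left ih (norm_nonneg w))
  have hzero : Filter.Tendsto (fun n ↦ (w * ·)^[n] u) Filter.atTop (nhds 0) := by
    refine squeeze_zero_norm hnorm ?_
    simpa using (tendsto_pow_atTop_nhds_zero_of_lt_one (norm_nonneg w) hlt).mul_const ‖u‖
  have hlim : Filter.Tendsto (fun n ↦ u - (w * ·)^[n] u) Filter.atTop (nhds u) := by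
    simpa using hzero.const_sub u
  exact hI.mem_of_tendsto hlim (Filter.Eventually.of_forall hsub)

/-- A spectral truncation `u` of a self-adjoint element `y` away from `[-q, q]`, with an
inverse `κ` of `y` there. -/
theorem IsSelfAdjoint.exists_mul_mul_eq_and_norm_le {N : Type*} [NonUnitalCStarAlgebra N] {y : N}
    (hy : IsSelfAdjoint y) {q : ℝ} (hq : 0 < q) :
    ∃ κ u : N, y * κ * u = u ∧ ‖κ‖ ≤ q⁻¹ ∧ ‖y - u‖ ≤ q := by
  let k : ℝ → ℝ := fun t ↦ t / max (t ^ 2) (q ^ 2)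
  let c : ℝ → ℝ := fun t ↦ max (-q) (min q t)
  have hden (t : ℝ) : max (t ^ 2) (q ^ 2) ≠ 0 := (lt_max_of_lt_right (by positivity)).ne'
  have hkc : Continuous k := by fun_prop (disch := exact hden _)
  have hcc : Continuous c := by fun_prop
  have hk0 : k 0 = 0 := by simp [k]
  have hc0 : c 0 = 0 := by simp [c, hq.le]
  have hmul (t : ℝ) : t * k t * (t - c t) = t - c t := by
    by_cases h : |t| ≤ q
    · have : c t = t := by
        obtain ⟨h1, h2⟩ := abs_le.1 h
        simp [c, h1, h2]
      simp [this]
    · have hlt : q < |t| := not_le.1 h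
      have hsq : q ^ 2 ≤ t ^ 2 := by
        rw [← sq_abs t]; gcongr
      have ht : t ≠ 0 := fun h0 ↦ by simp [h0] at hlt; linarith
      have : t * k t = 1 := by
        simp only [k, max_eq_left hsq]
        field_simp
      rw [this, one_mul]
  refine ⟨cfcₙ k y, cfcₙ (fun t ↦ t - c t) y, ?_, ?_, ?_⟩
  · have h1 : y * cfcₙ k y = cfcₙ (fun t ↦ t * k t) y := by
      rw [cfcₙ_mul (fun t : ℝ ↦ t) k y, cfcₙ_id' ℝ y]
    have h0 : (fun t ↦ t * k t) 0 = 0 := by simp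
    have h0' : (fun t ↦ t - c t) 0 = 0 := by simp [hc0]
    rw [h1, ← cfcₙ_mul (fun t ↦ t * k t) (fun t ↦ t - c t) y (by fun_prop) h0 (by fun_prop) h0']
    simp only [hmul]
  · refine norm_cfcₙ_le fun t _ ↦ ?_
    rw [Real.norm_eq_abs, abs_div, abs_of_pos (lt_of_le_of_ne (by positivity) (hden t).symm),
      div_le_iff₀ (lt_of_le_of_ne (by positivity) (hden t).symm), inv_mul_eq_div, le_div_iff₀ hq,
      ← sq_abs t]
    rcases le_total |t| q with h | h
    · exact le_trans (by nlinarith) (le_max_right _ _)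
    · exact le_trans (by nlinarith [abs_nonneg t]) (le_max_left _ _)
  · have h : y - cfcₙ (fun t ↦ t - c t) y = cfcₙ c y := by
      rw [cfcₙ_sub (fun t : ℝ ↦ t) c y, cfcₙ_id' ℝ y, sub_sub_cancel]
    rw [h]
    refine norm_cfcₙ_le fun t _ ↦ ?_
    rw [Real.norm_eq_abs, abs_le]
    exact ⟨le_max_left _ _, max_le (by linarith) (min_le_left _ _)⟩

/-- Every element of the additive subgroup generated by the products `a * x * b` is already
generated by those with `a` and `b` in some countable set. -/
theorem AddSubgroup.exists_countable_mem_closure_image2 {R : Type*} [NonUnitalRing R] {x s : R}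
    (hs : s ∈ AddSubgroup.closure (Set.image2 (fun a b ↦ a * x * b) Set.univ Set.univ)) :
    ∃ F : Set R, F.Countable ∧
      s ∈ AddSubgroup.closure (Set.image2 (fun a b ↦ a * x * b) F F) := by
  induction hs using AddSubgroup.closure_induction with
  | mem s hs =>
    obtain ⟨a, -, b, -, rfl⟩ := hs
    exact ⟨{a, b}, by simp, AddSubgroup.subset_closure ⟨a, by simp, b, by simp, rfl⟩⟩
  | zero => exact ⟨∅, Set.countable_empty, zero_mem _⟩
  | add s t _ _ hs ht =>
    obtain ⟨F, hF, hsF⟩ := hs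
    obtain ⟨G, hG, htG⟩ := ht
    refine ⟨F ∪ G, hF.union hG, add_mem ?_ ?_⟩
    · exact AddSubgroup.closure_mono
        (Set.image2_subset Set.subset_union_left Set.subset_union_left) hsF
    · exact AddSubgroup.closure_mono
        (Set.image2_subset Set.subset_union_right Set.subset_union_right) htG
  | neg s _ hs =>
    obtain ⟨F, hF, hsF⟩ := hs
    exact ⟨F, hF, neg_mem hsF⟩

/-- In a simple C*-algebra the products `a * x * b` with `x ≠ 0` span a dense subgroup. -/
theorem IsSimpleCStarAlgebra.mem_closure_addSubgroup_closure {N : Type*} [NonUnitalCStarAlgebra N]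
    (hN : IsSimpleCStarAlgebra N) {x : N} (hx : x ≠ 0) (y : N) :
    y ∈ closure (AddSubgroup.closure
      (Set.image2 (fun a b ↦ a * x * b) Set.univ Set.univ) : Set N) := by
  set T := Set.image2 (fun a b ↦ a * x * b) Set.univ Set.univ
  set G := (AddSubgroup.closure T).topologicalClosure with hG
  have hleft (a s : N) (hs : s ∈ G) : a * s ∈ G := by
    refine map_mem_closure (f := fun s ↦ a * s) (by fun_prop) hs fun s hs ↦ ?_
    induction hs using AddSubgroup.closure_induction with
    | mem s hs =>
      obtain ⟨b, -, c, -, rfl⟩ := hs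
      exact AddSubgroup.subset_closure ⟨a * b, trivial, c, trivial, by simp only [mul_assoc]⟩
    | zero => simp
    | add s t _ _ hs ht =>
      simpa only [mul_add, SetLike.mem_coe] using add_mem hs ht
    | neg s _ hs => simpa using hs
  have hright (s a : N) (hs : s ∈ G) : s * a ∈ G := by
    refine map_mem_closure (f := fun s ↦ s * a) (by fun_prop) hs fun s hs ↦ ?_
    induction hs using AddSubgroup.closure_induction with
    | mem s hs =>
      obtain ⟨b, -, c, -, rfl⟩ := hs
      exact AddSubgroup.subset_closure ⟨b, trivial, c * a, trivial, by simp only [mul_assoc]⟩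
    | zero => simp
    | add s t _ _ hs ht =>
      simpa only [add_mul, SetLike.mem_coe] using add_mem hs ht
    | neg s _ hs => simpa using hs
  let I : TwoSidedIdeal N := .mk' (G : Set N) G.zero_mem G.add_mem G.neg_mem
    (fun {a s} hs ↦ hleft a s hs) (fun {s a} hs ↦ hright s a hs)
  have hIG (z : N) : z ∈ I ↔ z ∈ G := TwoSidedIdeal.mem_mk' ..
  have hIclosed : IsClosed (I : Set N) := by
    rw [TwoSidedIdeal.coe_mk']
    exact AddSubgroup.isClosed_topologicalClosure _
  rcases hN I hIclosed with hbot | htop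
  · have hmem : star x * x * star x ∈ I := (hIG _).2 <| subset_closure <|
      AddSubgroup.subset_closure ⟨star x, trivial, star x, trivial, rfl⟩
    rw [hbot, TwoSidedIdeal.mem_bot] at hmem
    have h : star (star x * x) * (star x * x) = 0 := by
      rw [star_mul, star_star, ← mul_assoc, hmem, zero_mul]
    rw [CStarRing.star_mul_self_eq_zero_iff, CStarRing.star_mul_self_eq_zero_iff] at h
    exact absurd h hx
  · exact (hIG y).1 (htop ▸ trivial)

/-- In a simple C*-algebra, countably many `a`, `b` suffice to approximate `y` by sums of
products `± a * x * b`. -/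
theorem IsSimpleCStarAlgebra.exists_countable_mem_closure {N : Type*} [NonUnitalCStarAlgebra N]
    (hN : IsSimpleCStarAlgebra N) (x y : N) :
    ∃ F : Set N, F.Countable ∧ (x ≠ 0 →
      y ∈ closure (AddSubgroup.closure (Set.image2 (fun a b ↦ a * x * b) F F) : Set N)) := by
  by_cases hx : x = 0
  · exact ⟨∅, Set.countable_empty, fun h ↦ absurd hx h⟩
  obtain ⟨s, hs, hsy⟩ := mem_closure_iff_seq_limit.1 (hN.mem_closure_addSubgroup_closure hx y)
  choose F hF hsF using fun n ↦ AddSubgroup.exists_countable_mem_closure_image2 (hs n)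
  refine ⟨⋃ n, F n, Set.countable_iUnion hF, fun _ ↦ ?_⟩
  refine mem_closure_of_tendsto hsy (Filter.Eventually.of_forall fun n ↦ ?_)
  exact AddSubgroup.closure_mono
    (Set.image2_subset (Set.subset_iUnion F n) (Set.subset_iUnion F n)) (hsF n)

/-- The closure of a set that is closed under the algebraic operations, with scalars from a
dense subset of `ℂ`, as a star subalgebra. -/
def NonUnitalStarSubalgebra.ofClosure {N : Type*} [NonUnitalCStarAlgebra N] (T : Set N)
    (D : Set ℂ) (hD : Dense D) (hzero : 0 ∈ T) (hadd : ∀ x ∈ T, ∀ y ∈ T, x + y ∈ T)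
    (hmul : ∀ x ∈ T, ∀ y ∈ T, x * y ∈ T) (hsmul : ∀ c ∈ D, ∀ x ∈ T, c • x ∈ T)
    (hstar : ∀ x ∈ T, star x ∈ T) : NonUnitalStarSubalgebra ℂ N where
  carrier := closure T
  zero_mem' := subset_closure hzero
  add_mem' hx hy := map_mem_closure₂ continuous_add hx hy hadd
  mul_mem' hx hy := map_mem_closure₂ continuous_mul hx hy hmul
  smul_mem' c _ hx := map_mem_closure₂ continuous_smul (hD c) hx hsmul
  star_mem' hx := map_mem_closure continuous_star hx hstar

/-- **Blackadar's lemma.** If `N` is a simple C*-algebra and `A ⊆ N` is a separable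
C*-subalgebra, then there is a separable simple C*-subalgebra `B` with `A ⊆ B ⊆ N`. -/
theorem exists_separable_simple_intermediate_cstar_subalgebra
    (N : Type*) [NonUnitalCStarAlgebra N]
    (hN : IsSimpleCStarAlgebra N)
    (A : NonUnitalStarSubalgebra ℂ N) (hA_closed : IsClosed (A : Set N))
    (hA_sep : TopologicalSpace.SeparableSpace A) :
    ∃ B : NonUnitalStarSubalgebra ℂ N, IsClosed (B : Set N) ∧
      TopologicalSpace.SeparableSpace B ∧ A ≤ B ∧
      (∀ I : TwoSidedIdeal B, IsClosed (I : Set B) → I = ⊥ ∨ I = ⊤) := by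
  obtain ⟨S, hS, hAS⟩ : TopologicalSpace.IsSeparable (A : Set N) :=
    .of_subtype (A : Set N)
  obtain ⟨D, hDc, hD⟩ := TopologicalSpace.exists_countable_dense ℂ
  let h : N → N := fun x ↦ (2⁻¹ : ℂ) • (x + star x)
  have hh (x : N) : IsSelfAdjoint (h x) := by
    simp [IsSelfAdjoint, h, add_comm]
  have hh_of_sa {x : N} (hx : IsSelfAdjoint x) : h x = x := by
    simp only [h, hx.star_eq, ← two_smul ℂ x, smul_smul]
    norm_num
  have hh_cont : Continuous h := by fun_prop
  choose κ u hu hκ hyu using fun (x : N) (q : {q : ℚ // 0 < q}) ↦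
    (hh x).exists_mul_mul_eq_and_norm_le (q := (q : ℚ)) (by exact_mod_cast q.2)
  choose F hF hyF using hN.exists_countable_mem_closure
  let Φ : N → N → Set N := fun x y ↦
    {x + y, x * y, star x} ∪ (· • x) '' D ∪ Set.range (κ x) ∪ Set.range (u x) ∪ F x y
  have hΦ (x y : N) : (Φ x y).Countable := by
    refine ((((Set.Countable.union ?_ (hDc.image _)).union (Set.countable_range _)).union
      (Set.countable_range _)).union (hF x y))
    simp
  obtain ⟨T, hTc, hST, hT⟩ :=
    (hS.insert 0).exists_countable_superset_forall_subset Φ hΦ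
  let B : NonUnitalStarSubalgebra ℂ N := .ofClosure T D hD (hST (Set.mem_insert _ _))
    (fun x hx y hy ↦ hT x hx y hy (by simp [Φ])) (fun x hx y hy ↦ hT x hx y hy (by simp [Φ]))
    (fun c hc x hx ↦ hT x hx x hx <| .inl <| .inl <| .inl <| .inr ⟨c, hc, rfl⟩)
    (fun x hx ↦ hT x hx x hx (by simp [Φ]))
  have hBT : (B : Set N) = closure T := rfl
  have hTB {x : N} (hx : x ∈ T) : x ∈ B := subset_closure hx
  have hhB {x : N} (hx : x ∈ B) : h x ∈ B := B.smul_mem' _ (add_mem hx (star_mem hx))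
  refine ⟨B, isClosed_closure, ?_, ?_, fun I hI ↦ ?_⟩
  · exact (hTc.isSeparable.closure : TopologicalSpace.IsSeparable (B : Set N)).separableSpace
  · exact fun x hx ↦ closure_mono ((Set.subset_insert _ _).trans hST) (hAS hx)
  refine or_iff_not_imp_left.2 fun hbot ↦ ?_
  obtain ⟨x, hxI, hx0⟩ : ∃ x ∈ I, x ≠ 0 := by
    by_contra! hall
    exact hbot (le_bot_iff.1 fun x hx ↦ (TwoSidedIdeal.mem_bot _).2 (hall x hx))
  set z : B := star x * x with hz
  have hzI : z ∈ I := I.mul_mem_left _ _ hxI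
  have hz_sa : IsSelfAdjoint (z : N) := IsSelfAdjoint.star_mul_self (x : N)
  have hz0 : (z : N) ≠ 0 := by
    rw [hz]
    simpa [CStarRing.star_mul_self_eq_zero_iff] using hx0
  have hr : 0 < ‖(z : N)‖ := norm_pos_iff.2 hz0
  obtain ⟨q, hq0, hqz⟩ := exists_rat_btwn (half_pos hr)
  have hq : 0 < q := by exact_mod_cast hq0
  -- a member `y` of the countable set with self-adjoint part close to `z`
  obtain ⟨y, hyz, hyT⟩ : ∃ y ∈ {y : N | ‖h y - z‖ < q}, y ∈ T := by
    have hopen : IsOpen {y : N | ‖h y - z‖ < q} :=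
      isOpen_lt (by fun_prop) continuous_const
    refine mem_closure_iff.1 (show (z : N) ∈ closure T from z.2) _ hopen ?_
    simpa [hh_of_sa hz_sa] using hq
  let q' : {q : ℚ // 0 < q} := ⟨q, hq⟩
  have hκT : κ y q' ∈ T := hT y hyT y hyT (by simp [Φ])
  have huT : u y q' ∈ T := hT y hyT y hyT (by simp [Φ])
  have huI : (⟨u y q', hTB huT⟩ : B) ∈ I := by
    refine I.mem_of_mul_mul_eq_of_norm_lt_one hI (y := ⟨h y, hhB (hTB hyT)⟩)
      (κ := ⟨κ y q', hTB hκT⟩) hzI (Subtype.ext (hu y q')) ?_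
    calc ‖(h y - z) * κ y q'‖ ≤ ‖h y - z‖ * ‖κ y q'‖ := norm_mul_le _ _
      _ ≤ ‖h y - z‖ * (q : ℝ)⁻¹ := by gcongr; exact hκ y q'
      _ < 1 := by rw [← div_eq_mul_inv, div_lt_one (by exact_mod_cast hq)]; exact hyz
  have hTI (v : N) (hv : v ∈ T) : (⟨v, hTB hv⟩ : B) ∈ I := by
    have hu0 : u y q' ≠ 0 := fun h0 ↦ by
      have h1 := hyu y q'
      rw [h0, sub_zero] at h1
      have h2 := norm_sub_norm_le (z : N) (h y)
      rw [norm_sub_rev] at h2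
      have h3 : ‖h y - z‖ < q := hyz
      have h4 : ‖h y‖ ≤ (q : ℝ) := h1
      linarith
    have hFT : F (u y q') v ⊆ T := fun w hw ↦ hT _ huT _ hv (Or.inr hw)
    set H := AddSubgroup.closure (Set.image2 (fun a b ↦ a * u y q' * b)
      (F (u y q') v) (F (u y q') v))
    have hHI (s : N) (hs : s ∈ H) : ∃ b ∈ I, (b : N) = s := by
      induction hs using AddSubgroup.closure_induction with
      | mem s hs =>
        obtain ⟨a, ha, b, hb, rfl⟩ := hs
        exact ⟨⟨a, hTB (hFT ha)⟩ * ⟨u y q', hTB huT⟩ * ⟨b, hTB (hFT hb)⟩,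
          I.mul_mem_right _ _ (I.mul_mem_left _ _ huI), rfl⟩
      | zero => exact ⟨0, I.zero_mem, rfl⟩
      | add s t _ _ hs ht =>
        obtain ⟨b, hb, rfl⟩ := hs
        obtain ⟨c, hc, rfl⟩ := ht
        exact ⟨b + c, I.add_mem hb hc, rfl⟩
      | neg s _ hs =>
        obtain ⟨b, hb, rfl⟩ := hs
        exact ⟨-b, I.neg_mem hb, rfl⟩
    rw [← SetLike.mem_coe, ← hI.closure_eq, closure_subtype]
    exact closure_mono hHI (hyF _ v hu0)
  refine top_le_iff.1 fun v _ ↦ ?_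
  have hdense : Dense {v : B | (v : N) ∈ T} := by
    refine fun v ↦ closure_subtype.2 (closure_mono ?_ v.2)
    exact fun w hw ↦ ⟨⟨w, hTB hw⟩, hw, rfl⟩
  have hsub : {v : B | (v : N) ∈ T} ⊆ (I : Set B) := fun w hw ↦ hTI w hw
  exact closure_minimal hsub hI (hdense v)
end

section
/- Let N be a unital C*-algebra and let A be a separable C*-subalgebra of N containing the unit of N. Then there exists a separable C*-subalgebra B of N with A ⊆ B ⊆ N and 1 ∈ B such that for every positive integer m and every unitary u in the m×m matrix algebra M_m(B): if the image of u in M_m(N) under the entrywise inclusion B ↪ N is joined to the identity matrix by a continuous path of unitaries in M_m(N), then u is joined to the identity matrix by a continuous path of unitaries in M_m(B). -/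
open TopologicalSpace Set

/-- Given a set-valued operation on finite sets with countable values, every countable set is
contained in a countable set that is closed under the operation. -/
theorem Set.Countable.exists_countable_superset_closed {α : Type*} {S : Set α}
    (hS : S.Countable) (F : Set α → Set α) (hF : ∀ t, t.Finite → (F t).Countable) :
    ∃ T : Set α, T.Countable ∧ S ⊆ T ∧ ∀ t, t.Finite → t ⊆ T → F t ⊆ T := by
  let step : Set α → Set α := fun U ↦ U ∪ ⋃ t ∈ {t : Set α | t.Finite ∧ t ⊆ U}, F t
  let c : ℕ → Set α := fun n ↦ step^[n] S
  have hc_succ (n : ℕ) : c (n + 1) = step (c n) := Function.iterate_succ_apply' step n S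
  have hc_mono : Monotone c := monotone_nat_of_le_succ fun n ↦ by
    rw [hc_succ]; exact subset_union_left
  have hc_count (n : ℕ) : (c n).Countable := by
    induction n with
    | zero => exact hS
    | succ n ih =>
      rw [hc_succ]
      exact ih.union ((countable_ofPred_finite_subset ih).biUnion fun t ht ↦ hF t ht.1)
  refine ⟨⋃ n, c n, countable_iUnion hc_count, subset_iUnion c 0, fun t ht htc ↦ ?_⟩
  obtain ⟨n, hn⟩ : ∃ n, t ⊆ c n := by
    have := hc_mono.directed_le.exists_mem_subset_of_finset_subset_biUnion
      (s := ht.toFinset) (by simpa using htc)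
    simpa using this
  refine Subset.trans (fun x hx ↦ ?_) (subset_iUnion c (n + 1))
  rw [hc_succ]
  exact Or.inr (mem_biUnion (show t ∈ {t : Set α | t.Finite ∧ t ⊆ c n} from ⟨ht, hn⟩) hx)

/-- The closure of a set containing `1` that is closed under addition, multiplication, star and
multiplication by a dense set of scalars is a star subalgebra. -/
theorem StarSubalgebra.exists_coe_eq_closure {N : Type*} [CStarAlgebra N] {S : Set N} {Q : Set ℂ}
    (hQ : Dense Q) (one : (1 : N) ∈ S) (add : ∀ a ∈ S, ∀ b ∈ S, a + b ∈ S)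
    (mul : ∀ a ∈ S, ∀ b ∈ S, a * b ∈ S) (star_mem : ∀ a ∈ S, star a ∈ S)
    (smul : ∀ q ∈ Q, ∀ a ∈ S, q • a ∈ S) :
    ∃ B : StarSubalgebra ℂ N, (B : Set N) = closure S := by
  have hsmul (c : ℂ) {a : N} (ha : a ∈ closure S) : c • a ∈ closure S :=
    map_mem_closure₂ continuous_smul (hQ c) ha smul
  have hone : (1 : N) ∈ closure S := subset_closure one
  exact ⟨{  carrier := closure S
            add_mem' := fun ha hb ↦ map_mem_closure₂ continuous_add ha hb add
            mul_mem' := fun ha hb ↦ map_mem_closure₂ continuous_mul ha hb mul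
            one_mem' := hone
            zero_mem' := by simpa using hsmul 0 hone
            algebraMap_mem' := fun c ↦ by
              rw [Algebra.algebraMap_eq_smul_one]; exact hsmul c hone
            star_mem' := fun ha ↦ map_mem_closure continuous_star ha star_mem }, rfl⟩

/-- Unitary matrices over a C⋆-algebra whose entries are close enough are joined by a path of
unitary matrices. -/
theorem Matrix.exists_pos_joined_unitary {D n : Type*} [CStarAlgebra D] [Fintype n] [DecidableEq n]
    (u : unitary (Matrix n n D)) :
    ∃ δ > 0, ∀ v : unitary (Matrix n n D),
      (∀ i j, dist ((v : Matrix n n D) i j) ((u : Matrix n n D) i j) < δ) → Joined u v := by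
  let _ := CStarAlgebra.spectralOrder D
  have _ := CStarAlgebra.spectralOrderedRing D
  let toC : unitary (Matrix n n D) → unitary (CStarMatrix n n D) := fun w ↦
    ⟨CStarMatrix.ofMatrix w.1, w.2⟩
  let ofC : unitary (CStarMatrix n n D) → unitary (Matrix n n D) := fun w ↦
    ⟨CStarMatrix.ofMatrix.symm w.1, w.2⟩
  have hofC : Continuous ofC :=
    (CStarMatrix.ofMatrixL.symm.continuous.comp continuous_subtype_val).subtype_mk _
  have hopen : IsOpen {x : n → n → D |
      ‖CStarMatrix.ofMatrix (Matrix.of x) - CStarMatrix.ofMatrix u.1‖ < 2} :=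
    isOpen_lt ((CStarMatrix.ofMatrixL.continuous.sub continuous_const).norm) continuous_const
  obtain ⟨δ, hδ, hball⟩ := Metric.isOpen_iff.1 hopen (fun i j ↦ u.1 i j) (by
    change ‖CStarMatrix.ofMatrix u.1 - CStarMatrix.ofMatrix u.1‖ < 2
    simp)
  refine ⟨δ, hδ, fun v hv ↦ ?_⟩
  have hnorm : ‖((toC v : CStarMatrix n n D) - toC u : CStarMatrix n n D)‖ < 2 :=
    hball (a := fun i j ↦ v.1 i j)
      ((dist_pi_lt_iff hδ).2 fun i ↦ (dist_pi_lt_iff hδ).2 fun j ↦ hv i j)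
  exact (Unitary.joined (toC u) (toC v) hnorm).map hofC

/-- A matrix over a star subalgebra is unitary if it is unitary over the ambient algebra. -/
theorem Matrix.mem_unitary_of_map_coe_mem {N n : Type*} [CStarAlgebra N] [Fintype n]
    [DecidableEq n] {B : StarSubalgebra ℂ N} {w : Matrix n n B}
    (hw : w.map ((↑) : B → N) ∈ unitary (Matrix n n N)) : w ∈ unitary (Matrix n n B) := by
  have hinj : Function.Injective (B.subtype.toRingHom.mapMatrix (m := n)) :=
    Matrix.map_injective Subtype.val_injective
  have hstar : B.subtype.toRingHom.mapMatrix (star w) = star (w.map ((↑) : B → N)) := rfl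
  have hmap : B.subtype.toRingHom.mapMatrix w = w.map ((↑) : B → N) := rfl
  rw [Unitary.mem_iff] at hw ⊢
  constructor <;> apply hinj <;> rw [map_mul, map_one, hstar, hmap]
  exacts [hw.1, hw.2]

/-- A path of unitary matrices whose entries lie in a star subalgebra is a path of unitary
matrices over the subalgebra. -/
theorem Matrix.joined_unitary_of_path {N n : Type*} [CStarAlgebra N] [Fintype n] [DecidableEq n]
    {B : StarSubalgebra ℂ N} {v : unitary (Matrix n n N)} (γ : Path v 1)
    (hγ : ∀ t i j, (γ t : Matrix n n N) i j ∈ B) :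
    ∃ w : unitary (Matrix n n B), (w : Matrix n n B).map ((↑) : B → N) = v ∧ Joined w 1 := by
  let f : unitInterval → unitary (Matrix n n B) := fun t ↦
    ⟨Matrix.of fun i j ↦ ⟨(γ t : Matrix n n N) i j, hγ t i j⟩,
      Matrix.mem_unitary_of_map_coe_mem (γ t).2⟩
  have hf : Continuous f := by
    refine Continuous.subtype_mk (continuous_matrix fun i j ↦ Continuous.subtype_mk ?_ _) _
    exact (continuous_subtype_val.comp γ.continuous).matrix_elem i j
  have hmap (t) : (f t : Matrix n n B).map ((↑) : B → N) = (γ t : Matrix n n N) := rfl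
  have hone : f 1 = 1 := by
    refine Subtype.ext (Matrix.map_injective Subtype.val_injective ?_)
    refine (hmap 1).trans ?_
    rw [γ.target]
    exact (Matrix.map_one ((↑) : B → N) rfl rfl).symm
  exact ⟨f 0, by rw [hmap, γ.source], ⟨⟨⟨f, hf⟩, rfl, hone⟩⟩⟩

/-- A path of matrices has its entries in the closure of a countable set. -/
theorem Matrix.exists_countable_entries_mem_closure {N n : Type*} [CStarAlgebra N] [Finite n]
    {f : unitInterval → Matrix n n N} (hf : Continuous f) :
    ∃ G : Set N, G.Countable ∧ ∀ t i j, f t i j ∈ closure G := by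
  refine ⟨⋃ i, ⋃ j, (fun t ↦ f t i j) '' range (denseSeq unitInterval),
    countable_iUnion fun i ↦ countable_iUnion fun j ↦ (countable_range _).image _,
    fun t i j ↦ ?_⟩
  have := image_closure_subset_closure_image (hf.matrix_elem i j)
    (mem_image_of_mem _ (denseRange_denseSeq unitInterval t))
  exact closure_mono (subset_iUnion₂_of_subset i j Subset.rfl) this


/-- Given a unital C*-algebra `N` and a separable C*-subalgebra `A ⊆ N` containing the
unit, there is a separable C*-subalgebra `B` with `A ⊆ B ⊆ N` and `1 ∈ B` such that any
unitary of a matrix algebra `M_m(B)` whose image in `M_m(N)` is connected to the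
identity by a path of unitaries is already connected to the identity by a path of
unitaries of `M_m(B)`. -/
theorem exists_separable_intermediate_subalgebra_unitary_homotopy
    (N : Type*) [CStarAlgebra N]
    (A : StarSubalgebra ℂ N) (hA_closed : IsClosed (A : Set N))
    (hA_sep : TopologicalSpace.SeparableSpace A) :
    ∃ B : StarSubalgebra ℂ N, IsClosed (B : Set N) ∧
      TopologicalSpace.SeparableSpace B ∧ A ≤ B ∧ (1 : N) ∈ B ∧
      ∀ (m : ℕ), 0 < m →
        ∀ (u : Matrix (Fin m) (Fin m) B)
          (hu : u ∈ unitary (Matrix (Fin m) (Fin m) B))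
          (hu' : u.map ((↑) : B → N) ∈ unitary (Matrix (Fin m) (Fin m) N)),
          Joined (⟨u.map ((↑) : B → N), hu'⟩ : unitary (Matrix (Fin m) (Fin m) N)) 1 →
            Joined (⟨u, hu⟩ : unitary (Matrix (Fin m) (Fin m) B)) 1 := by
  classical
  obtain ⟨Q, hQc, hQd⟩ := exists_countable_dense ℂ
  obtain ⟨S₀, hS₀c, hS₀⟩ : ∃ S₀ : Set N, S₀.Countable ∧ (A : Set N) ⊆ closure S₀ :=
    IsSeparable.of_subtype (A : Set N)
  let Near (k m : ℕ) (x : Matrix (Fin m) (Fin m) N) (v : unitary (Matrix (Fin m) (Fin m) N)) :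
      Prop := ∀ i j, dist ((v : Matrix (Fin m) (Fin m) N) i j) (x i j) < 1 / ((k : ℝ) + 1)
  have hG (k m : ℕ) (x : Matrix (Fin m) (Fin m) N) : ∃ G : Set N, G.Countable ∧
      ((∃ v, Near k m x v ∧ Joined v 1) → ∃ v, Near k m x v ∧ ∃ γ : Path v 1,
        ∀ t i j, (γ t : Matrix (Fin m) (Fin m) N) i j ∈ closure G) := by
    by_cases h : ∃ v, Near k m x v ∧ Joined v 1
    · obtain ⟨v, hv, ⟨γ⟩⟩ := h
      obtain ⟨G, hGc, hG⟩ := Matrix.exists_countable_entries_mem_closure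
        (continuous_subtype_val.comp γ.continuous)
      exact ⟨G, hGc, fun _ ↦ ⟨v, hv, γ, hG⟩⟩
    · exact ⟨∅, countable_empty, fun h' ↦ absurd h' h⟩
  choose G hGc hG using hG
  let F : Set N → Set N := fun t ↦ image2 (· + ·) t t ∪ image2 (· * ·) t t ∪ star '' t ∪
    image2 (· • ·) Q t ∪ ⋃ k, ⋃ m, ⋃ x ∈ {x : Matrix (Fin m) (Fin m) N | ∀ i j, x i j ∈ t}, G k m x
  have hF (t : Set N) (ht : t.Finite) : (F t).Countable := by
    have htc := ht.countable
    refine ((((htc.image2 htc _).union (htc.image2 htc _)).union (htc.image _)).union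
      (hQc.image2 htc _)).union (countable_iUnion fun k ↦ countable_iUnion fun m ↦
        Countable.biUnion ?_ fun x _ ↦ hGc k m x)
    exact (Finite.pi' fun _ ↦ Finite.pi' fun _ ↦ ht).countable
  obtain ⟨S, hSc, hS₀S, hS⟩ :=
    (hS₀c.insert 1).exists_countable_superset_closed F hF
  have hpair {a b : N} (ha : a ∈ S) (hb : b ∈ S) : F {a, b} ⊆ S :=
    hS _ (toFinite _) (insert_subset ha (singleton_subset_iff.2 hb))
  obtain ⟨B, hB⟩ := StarSubalgebra.exists_coe_eq_closure hQd (hS₀S (mem_insert _ _))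
    (fun a ha b hb ↦ hpair ha hb <| Or.inl <| Or.inl <| Or.inl <| Or.inl
      ⟨a, by simp, b, by simp, rfl⟩)
    (fun a ha b hb ↦ hpair ha hb <| Or.inl <| Or.inl <| Or.inl <| Or.inr
      ⟨a, by simp, b, by simp, rfl⟩)
    (fun a ha ↦ hpair ha ha <| Or.inl <| Or.inl <| Or.inr ⟨a, by simp, rfl⟩)
    (fun q hq a ha ↦ hpair ha ha <| Or.inl <| Or.inr ⟨q, hq, a, by simp, rfl⟩)
  have hGS (k m : ℕ) (x : Matrix (Fin m) (Fin m) N) (hx : ∀ i j, x i j ∈ S) : G k m x ⊆ S := by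
    refine Subset.trans (fun y hy ↦ Or.inr ?_) (hS (range fun p : Fin m × Fin m ↦ x p.1 p.2)
      (finite_range _) (range_subset_iff.2 fun p ↦ hx p.1 p.2))
    exact mem_iUnion₂.2 ⟨k, m, mem_biUnion (fun i j ↦ ⟨(i, j), rfl⟩) hy⟩
  have hBclosed : IsClosed (B : Set N) := hB ▸ isClosed_closure
  refine ⟨B, hBclosed, ?_, ?_, B.one_mem, fun m _ u hu hu' huj ↦ ?_⟩
  · have : IsSeparable (B : Set N) := hB ▸ hSc.isSeparable.closure
    exact this.separableSpace
  · intro a ha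
    rw [← SetLike.mem_coe, hB]
    exact closure_mono ((subset_insert _ _).trans hS₀S) (hS₀ ha)
  · obtain ⟨δ, hδ, hjoin⟩ := Matrix.exists_pos_joined_unitary
      (⟨u, hu⟩ : unitary (Matrix (Fin m) (Fin m) B))
    obtain ⟨k, hk⟩ := exists_nat_one_div_lt (half_pos hδ)
    have hx (i j : Fin m) : ∃ y ∈ S, dist (u i j : N) y < 1 / ((k : ℝ) + 1) :=
      Metric.mem_closure_iff.1 (hB ▸ (u i j).2) _ Nat.one_div_pos_of_nat
    choose x hxS hxu using hx
    obtain ⟨v, hv, γ, hγ⟩ := hG k m x ⟨_, hxu, huj⟩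
    obtain ⟨w, hw, hwj⟩ := Matrix.joined_unitary_of_path γ fun t i j ↦
      show _ ∈ (B : Set N) from hB.symm ▸ closure_mono (hGS k m x hxS) (hγ t i j)
    refine (hjoin w fun i j ↦ ?_).trans hwj
    have hwv : ((w : Matrix (Fin m) (Fin m) B) i j : N) = (v : Matrix (Fin m) (Fin m) N) i j :=
      congrFun₂ hw i j
    rw [Subtype.dist_eq, hwv]
    calc _ ≤ dist _ (x i j) + dist (u i j : N) (x i j) := dist_triangle_right _ _ _
      _ < δ := by linarith [hv i j, hxu i j]
end

section
/- Let N be a unital C*-algebra and let A be a separable C*-subalgebra of N containing the unit of N. Then there exists a separable C*-subalgebra B of N with A ⊆ B ⊆ N and 1 ∈ B such that for every positive integer m and all projections p, q in the m×m matrix algebra M_m(B): if there exists s ∈ M_m(N) with s*s equal to the image of p and ss* equal to the image of q under the entrywise inclusion B ↪ N, then there exists t ∈ M_m(B) with t*t = p and tt* = q. -/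
open Set TopologicalSpace

theorem isUnit_of_norm_sub_one_lt {M : Type*} [CStarAlgebra M] {a : M} (h : ‖a - 1‖ < 1) :
    IsUnit a := by
  rw [norm_sub_rev] at h
  simpa using isUnit_one_sub_of_norm_lt_one h

theorem exists_mvN_equiv_of_isUnit {M : Type*} [CStarAlgebra M] {p q y : M}
    (hp : IsStarProjection p) (hq : IsStarProjection q) (hyp : y * p = y) (hqy : q * y = y)
    (ha : IsUnit (star y * y + (1 - p))) (hc : IsUnit (y * star y + (1 - q))) :
    ∃ t : M, star t * t = p ∧ t * star t = q := by
  let _ := CStarAlgebra.spectralOrder M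
  have := CStarAlgebra.spectralOrderedRing M
  have hpp := hp.isIdempotentElem.eq
  have hps := hp.isSelfAdjoint.star_eq
  have hqq := hq.isIdempotentElem.eq
  have hqs := hq.isSelfAdjoint.star_eq
  have hpy : p * star y = star y := by simpa [hps] using congrArg star hyp
  have hyq : star y * q = star y := by simpa [hqs] using congrArg star hqy
  set a := star y * y + (1 - p) with hadef
  have hap : a * p = star y * y := by
    simp [hadef, add_mul, sub_mul, mul_assoc, hyp, hpp]
  have hpa : p * a = star y * y := by
    simp [hadef, mul_add, mul_sub, ← mul_assoc, hpy, hpp]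
  have hanonneg : 0 ≤ a := add_nonneg (star_mul_self_nonneg y) hp.one_sub.nonneg
  have hapos : IsStrictlyPositive a := ha.isStrictlyPositive hanonneg
  set b := a ^ (-(1 / 2) : ℝ) with hbdef
  have hbs : star b = b := (IsSelfAdjoint.of_nonneg (CFC.rpow_nonneg)).star_eq
  have hba : b * b * a = 1 := by
    rw [hbdef, ← CFC.rpow_add ha]
    nth_rw 2 [← CFC.rpow_one a]
    rw [← CFC.rpow_add ha]
    norm_num
    exact CFC.rpow_zero a
  have hbp : b * p = p * b := by
    have : Commute a p := by rw [Commute, SemiconjBy, hap, hpa]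
    exact (this.cfc_nnreal _).eq
  have hbca : b * a = a * b := ((Commute.refl a).cfc_nnreal _).eq
  have htt : star (y * b) * (y * b) = p := by
    calc star (y * b) * (y * b) = b * (star y * y) * b := by simp [hbs, mul_assoc]
      _ = (b * a) * (p * b) := by rw [← hap]; simp only [mul_assoc]
      _ = b * b * a * p := by
        rw [← hbp, hbca, mul_assoc b b a, hbca]
        simp only [mul_assoc]
        rw [← mul_assoc a b, ← hbca, mul_assoc]
      _ = p := by rw [hba, one_mul]
  refine ⟨y * b, htt, ?_⟩
  set r := y * b * star (y * b) with hr
  have hrq : r * q = r := by simp [hr, mul_assoc, hyq]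
  have hry : r * y = y := by
    calc r * y = y * (b * b) * (star y * y) := by simp [hr, hbs, mul_assoc]
      _ = y * (b * b * a) * p := by rw [← hap]; simp only [mul_assoc]
      _ = y := by rw [hba, mul_one, hyp]
  have h0 : (r - q) * (y * star y + (1 - q)) = 0 := by
    simp [mul_add, sub_mul, mul_sub, ← mul_assoc, hry, hqy, hrq, hqq]
  exact sub_eq_zero.mp (hc.mul_left_eq_zero.mp h0)

theorem norm_star_mul_mul_sub_lt {M : Type*} [CStarAlgebra M] {p q x : M}
    (hp : IsStarProjection p) (hq : IsStarProjection q)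
    (hxp : ‖star x * x - p‖ < 1 / 10) (hxq : ‖x * star x - q‖ < 1 / 10) :
    ‖star (q * x * p) * (q * x * p) - p‖ < 1 := by
  have hpp := hp.isIdempotentElem.eq
  have hp1 : ‖p‖ ≤ 1 := hp.norm_le
  have hxx : ‖x‖ * ‖x‖ ≤ 11 / 10 := by
    rw [← CStarRing.norm_star_mul_self]
    linarith [norm_le_norm_add_norm_sub' (star x * x) p]
  have hx : ‖x‖ ≤ 11 / 10 := by nlinarith [norm_nonneg x]
  have e : star (q * x * p) * (q * x * p) - p =
      p * (star x * ((q - x * star x) * x) +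
        (star x * x * (star x * x - p) + (star x * x - p) * p)) * p := by
    have : star (q * x * p) * (q * x * p) = p * (star x * (q * x)) * p := by
      simp only [star_mul, hp.isSelfAdjoint.star_eq, hq.isSelfAdjoint.star_eq, mul_assoc]
      rw [← mul_assoc q q, hq.isIdempotentElem.eq]
    rw [this]
    have h3 : p = p * (p * p) * p := by simp [hpp]
    nth_rw 3 [h3]
    rw [← sub_mul, ← mul_sub]
    congr 2
    noncomm_ring
  have ha : ‖star x * x‖ ≤ 11 / 10 := by rw [CStarRing.norm_star_mul_self]; exact hxx
  have h1 : ‖star x * ((q - x * star x) * x)‖ ≤ 11 / 100 := by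
    calc _ ≤ ‖star x‖ * (‖q - x * star x‖ * ‖x‖) :=
          (norm_mul_le _ _).trans (by gcongr; exact norm_mul_le _ _)
      _ = ‖x * star x - q‖ * (‖x‖ * ‖x‖) := by rw [norm_star, norm_sub_rev]; ring
      _ ≤ 1 / 10 * (11 / 10) := by gcongr
      _ = _ := by norm_num
  have h2 : ‖star x * x * (star x * x - p)‖ ≤ 11 / 10 * (1 / 10) :=
    (norm_mul_le _ _).trans (by gcongr)
  have h3 : ‖(star x * x - p) * p‖ ≤ 1 / 10 * 1 := (norm_mul_le _ _).trans (by gcongr)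
  have hw : ∀ w : M, ‖p * w * p‖ ≤ ‖w‖ := fun w => by
    calc _ ≤ ‖p‖ * ‖w‖ * ‖p‖ := (norm_mul_le _ _).trans (by gcongr; exact norm_mul_le _ _)
      _ ≤ 1 * ‖w‖ * 1 := by gcongr
      _ = _ := by ring
  rw [e]
  refine (hw _).trans_lt ?_
  refine (norm_add_le_of_le h1 (norm_add_le_of_le h2 h3)).trans_lt ?_
  norm_num


theorem exists_mvN_equiv_of_approx {M : Type*} [CStarAlgebra M] {p q x : M}
    (hp : IsStarProjection p) (hq : IsStarProjection q)
    (hxp : ‖star x * x - p‖ < 1 / 10) (hxq : ‖x * star x - q‖ < 1 / 10) :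
    ∃ t : M, star t * t = p ∧ t * star t = q := by
  have h1 := norm_star_mul_mul_sub_lt hp hq hxp hxq
  have h2 := norm_star_mul_mul_sub_lt (x := star x) hq hp (by simpa using hxq) (by simpa using hxp)
  have e : p * star x * q = star (q * x * p) := by
    simp [hp.isSelfAdjoint.star_eq, hq.isSelfAdjoint.star_eq, mul_assoc]
  rw [e, star_star] at h2
  refine exists_mvN_equiv_of_isUnit (y := q * x * p) hp hq ?_ ?_ ?_ ?_
  · rw [mul_assoc, hp.isIdempotentElem.eq]
  · rw [mul_assoc, ← mul_assoc q, hq.isIdempotentElem.eq]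
  · exact isUnit_of_norm_sub_one_lt (by convert h1 using 2; abel)
  · exact isUnit_of_norm_sub_one_lt (by convert h2 using 2; abel)

theorem Matrix.exists_mvN_equiv_of_mem_closure {B : Type*} [CStarAlgebra B] {m : Type*} [Fintype m]
    [DecidableEq m] {p q : Matrix m m B}
    (hp : IsStarProjection p) (hq : IsStarProjection q)
    (h : (p, q) ∈ closure (range fun x : Matrix m m B => (star x * x, x * star x))) :
    ∃ t : Matrix m m B, star t * t = p ∧ t * star t = q := by
  let _ := CStarAlgebra.spectralOrder B
  have := CStarAlgebra.spectralOrderedRing B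
  change ∃ t : CStarMatrix m m B, star t * t = CStarMatrix.ofMatrix p ∧
    t * star t = CStarMatrix.ofMatrix q
  have hp' : IsStarProjection (CStarMatrix.ofMatrix p) := ⟨hp.1, hp.2⟩
  have hq' : IsStarProjection (CStarMatrix.ofMatrix q) := ⟨hq.1, hq.2⟩
  have h' : (CStarMatrix.ofMatrix p, CStarMatrix.ofMatrix q) ∈
    closure (range fun x : CStarMatrix m m B => (star x * x, x * star x)) := h
  obtain ⟨_, ⟨x, rfl⟩, hx⟩ := Metric.mem_closure_iff.mp h' (1 / 10) (by norm_num)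
  rw [dist_comm, Prod.dist_eq, max_lt_iff, dist_eq_norm, dist_eq_norm] at hx
  exact exists_mvN_equiv_of_approx hp' hq' hx.1 hx.2

theorem exists_countable_dist_lt_dist_add {X Y : Type*} [PseudoMetricSpace Y] (f : X → Y)
    {Z : Set Y} (hZ : IsSeparable Z) :
    ∃ X₀ : Set X, X₀.Countable ∧
      ∀ z ∈ Z, ∀ x, ∀ ε > 0, ∃ x' ∈ X₀, dist (f x') z < dist (f x) z + ε := by
  obtain ⟨D, hD, hZD⟩ := hZ
  have := hD.to_subtype
  choose g hg using fun i : {i : D × ℚ // ∃ x, dist (f x) i.1 < i.2} => i.2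
  refine ⟨range g, countable_range g, fun z hz x ε hε => ?_⟩
  obtain ⟨d, hd, hzd⟩ := Metric.mem_closure_iff.mp (hZD hz) (ε / 3) (by positivity)
  obtain ⟨r, hr, hr'⟩ := exists_rat_btwn (show dist (f x) d < dist (f x) d + ε / 3 by linarith)
  refine ⟨_, ⟨⟨(⟨d, hd⟩, r), x, hr⟩, rfl⟩, ?_⟩
  have h := hg ⟨(⟨d, hd⟩, r), x, hr⟩
  dsimp only at h
  have h1 := dist_triangle (f (g ⟨(⟨d, hd⟩, r), x, hr⟩)) d z
  have h2 := dist_triangle (f x) z d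
  rw [dist_comm d z] at h1
  linarith

theorem Algebra.isSeparable_adjoin {R A : Type*} [CommSemiring R] [TopologicalSpace R]
    [SeparableSpace R] [Semiring A] [Algebra R A] [TopologicalSpace A] [ContinuousAdd A]
    [ContinuousSMul R A] {s : Set A} (hs : s.Countable) :
    IsSeparable (Algebra.adjoin R s : Set A) := by
  rw [← Subalgebra.coe_toSubmodule, Algebra.adjoin_eq_span]
  refine (Set.Countable.isSeparable ?_).span
  have := hs.to_subtype
  rw [Submonoid.closure_eq_mrange, MonoidHom.coe_mrange]
  have : Countable (FreeMonoid s) := inferInstanceAs (Countable (List s))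
  exact countable_range _

theorem StarSubalgebra.exists_le_isSeparable {N : Type*} [CStarAlgebra N] {B : StarSubalgebra ℂ N}
    (hB : IsSeparable (B : Set N)) {s : Set N} (hs : s.Countable) :
    ∃ C : StarSubalgebra ℂ N, IsSeparable (C : Set N) ∧ B ≤ C ∧ s ⊆ C := by
  obtain ⟨D, hD, hBD⟩ := hB
  set E := D ∪ s
  have hE : (E ∪ star E).Countable := by
    have h : E.Countable := hD.union hs
    exact h.union (by rw [← Set.image_star]; exact h.image _)
  refine ⟨(StarAlgebra.adjoin ℂ E).topologicalClosure, ?_, ?_, ?_⟩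
  · rw [StarSubalgebra.topologicalClosure_coe]
    exact (Algebra.isSeparable_adjoin hE).closure
  · intro x hx
    exact closure_mono (subset_union_left.trans (StarAlgebra.subset_adjoin ℂ E)) (hBD hx)
  · exact subset_union_right.trans ((StarAlgebra.subset_adjoin ℂ E).trans
      (StarSubalgebra.le_topologicalClosure _))

/-- The pair `(x⋆x, xx⋆)` of a square matrix `x`, viewed in a product of function spaces. -/
def mvNPair {N : Type*} [CStarAlgebra N] {m : ℕ} (x : Matrix (Fin m) (Fin m) N) :
    (Fin m → Fin m → N) × (Fin m → Fin m → N) :=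
  (star x * x, x * star x)

theorem StarSubalgebra.exists_isSeparable_step {N : Type*} [CStarAlgebra N]
    {B : StarSubalgebra ℂ N} (hB : IsSeparable (B : Set N)) :
    ∃ C : StarSubalgebra ℂ N, IsSeparable (C : Set N) ∧ B ≤ C ∧
      ∀ (m : ℕ) (z : (Fin m → Fin m → N) × (Fin m → Fin m → N)),
        (∀ i j, z.1 i j ∈ B) → (∀ i j, z.2 i j ∈ B) →
        ∀ (x : Matrix (Fin m) (Fin m) N), ∀ ε > 0, ∃ y : Matrix (Fin m) (Fin m) N,
          (∀ i j, y i j ∈ C) ∧ dist (mvNPair y) z < dist (mvNPair x) z + ε := by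
  have hZ (m : ℕ) : IsSeparable {w : Fin m → Fin m → N | ∀ i j, w i j ∈ B} :=
    isSeparable_pi (s := fun _ => {v : Fin m → N | ∀ j, v j ∈ B})
      fun _ => isSeparable_pi (s := fun _ => (B : Set N)) fun _ => hB
  choose X hX hXz using fun m : ℕ => exists_countable_dist_lt_dist_add
    (mvNPair (N := N) (m := m)) ((hZ m).prod (hZ m))
  obtain ⟨C, hC, hBC, hsC⟩ := StarSubalgebra.exists_le_isSeparable hB
    (s := ⋃ (m : ℕ) (i : Fin m) (j : Fin m), (fun x : Matrix (Fin m) (Fin m) N => x i j) '' X m)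
    (countable_iUnion fun m => countable_iUnion fun _ => countable_iUnion fun _ => (hX m).image _)
  refine ⟨C, hC, hBC, fun m z hz₁ hz₂ x ε hε => ?_⟩
  obtain ⟨y, hy, h⟩ := hXz m z ⟨hz₁, hz₂⟩ x ε hε
  refine ⟨y, fun i j => hsC ?_, h⟩
  simp only [mem_iUnion]
  exact ⟨m, i, j, y, hy, rfl⟩

theorem Monotone.exists_forall_mem_dist_lt {ι X : Type*} [Finite ι] [PseudoMetricSpace X]
    {B : ℕ → Set X} (hB : Monotone B) {w : ι → X} (hw : ∀ i, w i ∈ closure (⋃ k, B k))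
    {ε : ℝ} (hε : 0 < ε) : ∃ k, ∃ v : ι → X, ∀ i, v i ∈ B k ∧ dist (w i) (v i) < ε := by
  have := Fintype.ofFinite ι
  have h : ∀ i, ∃ v, ∃ k, v ∈ B k ∧ dist (w i) v < ε := fun i => by
    obtain ⟨v, hv, hd⟩ := Metric.mem_closure_iff.mp (hw i) ε hε
    obtain ⟨k, hk⟩ := mem_iUnion.mp hv
    exact ⟨v, k, hk, hd⟩
  choose v k hk hd using h
  exact ⟨Finset.univ.sup k, v, fun i => ⟨hB (Finset.le_sup (Finset.mem_univ i)) (hk i), hd i⟩⟩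

theorem StarSubalgebra.exists_monotone_chain {N : Type*} [CStarAlgebra N]
    {A : StarSubalgebra ℂ N} (hA : IsSeparable (A : Set N)) :
    ∃ B : ℕ → StarSubalgebra ℂ N, B 0 = A ∧ Monotone B ∧ (∀ k, IsSeparable (B k : Set N)) ∧
      ∀ (k m : ℕ) (z : (Fin m → Fin m → N) × (Fin m → Fin m → N)),
        (∀ i j, z.1 i j ∈ B k) → (∀ i j, z.2 i j ∈ B k) →
        ∀ (x : Matrix (Fin m) (Fin m) N), ∀ ε > 0, ∃ y : Matrix (Fin m) (Fin m) N,
          (∀ i j, y i j ∈ B (k + 1)) ∧ dist (mvNPair y) z < dist (mvNPair x) z + ε := by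
  choose F hF hle happrox using
    fun B : {B : StarSubalgebra ℂ N // IsSeparable (B : Set N)} =>
      StarSubalgebra.exists_isSeparable_step B.2
  let G : ℕ → {B : StarSubalgebra ℂ N // IsSeparable (B : Set N)} :=
    fun k => Nat.rec ⟨A, hA⟩ (fun _ B => ⟨F B, hF B⟩) k
  exact ⟨fun k => (G k).1, rfl, monotone_nat_of_le_succ fun k => hle (G k), fun k => (G k).2,
    fun k => happrox (G k)⟩


/-- Given a unital C*-algebra `N` and a separable C*-subalgebra `A ⊆ N` containing the
unit, there is a separable C*-subalgebra `B` with `A ⊆ B ⊆ N` and `1 ∈ B` such that any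
two projections of a matrix algebra `M_m(B)` which become Murray–von Neumann equivalent
in `M_m(N)` are already Murray–von Neumann equivalent in `M_m(B)`. -/
theorem exists_separable_intermediate_subalgebra_mvN_equiv
    (N : Type*) [CStarAlgebra N]
    (A : StarSubalgebra ℂ N) (hA_closed : IsClosed (A : Set N))
    (hA_sep : TopologicalSpace.SeparableSpace A) :
    ∃ B : StarSubalgebra ℂ N, IsClosed (B : Set N) ∧
      TopologicalSpace.SeparableSpace B ∧ A ≤ B ∧ (1 : N) ∈ B ∧
      ∀ (m : ℕ), 0 < m →
        ∀ p q : Matrix (Fin m) (Fin m) B,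
          star p = p → p * p = p → star q = q → q * q = q →
          (∃ s : Matrix (Fin m) (Fin m) N,
            star s * s = p.map ((↑) : B → N) ∧ s * star s = q.map ((↑) : B → N)) →
          ∃ t : Matrix (Fin m) (Fin m) B, star t * t = p ∧ t * star t = q := by
  have hA : IsSeparable (A : Set N) := by
    have : SeparableSpace (A : Set N) := hA_sep
    exact .of_subtype (A : Set N)
  obtain ⟨B, hB0, hmono, hsep, happrox⟩ := StarSubalgebra.exists_monotone_chain hA
  have hcoe : ((⨆ k, B k : StarSubalgebra ℂ N) : Set N) = ⋃ k, (B k : Set N) :=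
    StarSubalgebra.coe_iSup_of_directed hmono.directed_le
  set C := (⨆ k, B k : StarSubalgebra ℂ N).topologicalClosure
  have hC : (C : Set N) = closure (⋃ k, (B k : Set N)) := by
    rw [StarSubalgebra.topologicalClosure_coe, hcoe]
  have hBC (k : ℕ) : B k ≤ C := (le_iSup B k).trans (StarSubalgebra.le_topologicalClosure _)
  have hclosed : IsClosed (C : Set N) := StarSubalgebra.isClosed_topologicalClosure _
  refine ⟨C, hclosed, ?_, hB0 ▸ hBC 0, one_mem C, ?_⟩
  · exact IsSeparable.separableSpace (hC ▸ (IsSeparable.iUnion hsep).closure)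
  rintro m - p q hp hpp hq hqq ⟨s, hsp, hsq⟩
  refine Matrix.exists_mvN_equiv_of_mem_closure ⟨hpp, hp⟩ ⟨hqq, hq⟩ ?_
  let e : Matrix (Fin m) (Fin m) C → Fin m → Fin m → N := fun x i j => x i j
  have he : Topology.IsInducing e :=
    .piMap fun _ => .piMap fun _ => .subtypeVal
  rw [(he.prodMap he).closure_eq_preimage_closure_image, mem_preimage, Metric.mem_closure_iff]
  intro ε hε
  have hmem (w : Matrix (Fin m) (Fin m) C) (i : Fin m × Fin m) :
      (w i.1 i.2 : N) ∈ closure (⋃ k, (B k : Set N)) := hC ▸ (w i.1 i.2).2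
  obtain ⟨k, v, hv⟩ := Monotone.exists_forall_mem_dist_lt (B := fun k => (B k : Set N)) hmono
    (hmem p) (show 0 < ε / 3 by positivity)
  obtain ⟨l, u, hu⟩ := Monotone.exists_forall_mem_dist_lt (B := fun k => (B k : Set N)) hmono
    (hmem q) (show 0 < ε / 3 by positivity)
  let z : (Fin m → Fin m → N) × (Fin m → Fin m → N) := (fun i j => v (i, j), fun i j => u (i, j))
  have hz : dist (e p, e q) z < ε / 3 := by
    simp only [Prod.dist_eq, max_lt_iff, dist_pi_lt_iff (show 0 < ε / 3 by positivity)]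
    exact ⟨fun i j => (hv (i, j)).2, fun i j => (hu (i, j)).2⟩
  obtain ⟨y, hy, hyz⟩ := happrox (max k l) m z
    (fun i j => hmono (le_max_left k l) (hv (i, j)).1)
    (fun i j => hmono (le_max_right k l) (hu (i, j)).1) s (ε / 3) (by positivity)
  have hs : mvNPair s = (e p, e q) := Prod.ext hsp hsq
  let t : Matrix (Fin m) (Fin m) C := fun i j => ⟨y i j, hBC _ (hy i j)⟩
  have ht : mvNPair y = Prod.map e e (star t * t, t * star t) := by
    have hty (i j : Fin m) : y i j = t i j := rfl
    ext i j <;> simp [mvNPair, e, hty, Matrix.mul_apply, Matrix.star_apply]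
  refine ⟨_, mem_image_of_mem _ ⟨t, rfl⟩, ?_⟩
  rw [← ht, Prod.map_apply]
  rw [hs] at hyz
  have := dist_triangle_right (e p, e q) (mvNPair y) z
  linarith
end

section
/- Let N be a unital C*-algebra and let A be a separable C*-subalgebra of N containing the unit of N. Then there exists a separable C*-subalgebra B of N with A ⊆ B ⊆ N and 1 ∈ B such that for every positive integer m and all projections p, q in the m×m matrix algebra M_m(B): if there exist s ∈ M_m(N) and a projection e ∈ M_m(N) with e ≤ image of q, s*s = image of p, and ss* = e (p is Murray–von Neumann subequivalent to q in M_m(N)), then there exist t ∈ M_m(B) and a projection f ∈ M_m(B) with f ≤ q, t*t = p, and tt* = f. -/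
/-- A countable set has a countable extension that is stable under a given countable family of
finitary operations. -/
theorem Set.Countable.exists_superset_closed_under {X ι : Type*} [Countable ι] {α : ι → Type*}
    [∀ i, Finite (α i)] (F : ∀ i, (α i → X) → X) {S : Set X} (hS : S.Countable) :
    ∃ U : Set X, U.Countable ∧ S ⊆ U ∧ ∀ i v, (∀ j, v j ∈ U) → F i v ∈ U := by
  let step : Set X → Set X := fun T => T ∪ ⋃ i, F i '' {v | ∀ j, v j ∈ T}
  let D : ℕ → Set X := fun n => step^[n] S
  have hD_succ (n : ℕ) : D (n + 1) = step (D n) := Function.iterate_succ_apply' step n S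
  have hD_mono : Monotone D := monotone_nat_of_le_succ fun n => by
    rw [hD_succ]
    exact Set.subset_union_left
  have hD_countable (n : ℕ) : (D n).Countable := by
    induction n with
    | zero => exact hS
    | succ n ih =>
      rw [hD_succ]
      exact ih.union (Set.countable_iUnion fun i => (Set.countable_pi fun _ => ih).image _)
  refine ⟨⋃ n, D n, Set.countable_iUnion hD_countable, Set.subset_iUnion D 0, fun i v hv => ?_⟩
  choose k hk using fun j => Set.mem_iUnion.mp (hv j)
  obtain ⟨K, hK⟩ := (Set.finite_range k).bddAbove
  refine Set.mem_iUnion.mpr ⟨K + 1, ?_⟩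
  rw [hD_succ]
  exact Or.inr (Set.mem_iUnion.mpr
    ⟨i, v, fun j => hD_mono (hK (Set.mem_range_self j)) (hk j), rfl⟩)

/-- The closure of a set that contains `0` and `1` and is stable under the operations
`(x, y, z) ↦ r k • x + star y * z`, for a dense sequence `r` of scalars, is a star subalgebra. -/
theorem StarSubalgebra.exists_coe_eq_closure_s8 {N : Type*} [NormedRing N] [StarRing N]
    [NormedAlgebra ℂ N] [ContinuousStar N] [StarModule ℂ N] {r : ℕ → ℂ} (hr : DenseRange r)
    {U : Set N} (h0 : 0 ∈ U) (h1 : 1 ∈ U)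
    (hU : ∀ k, ∀ x ∈ U, ∀ y ∈ U, ∀ z ∈ U, r k • x + star y * z ∈ U) :
    ∃ B : StarSubalgebra ℂ N, (B : Set N) = closure U := by
  have key (c : ℂ) (x y z : N) (hx : x ∈ closure U) (hy : y ∈ closure U) (hz : z ∈ closure U) :
      c • x + star y * z ∈ closure U := by
    have hf : Continuous fun w : ℂ × N × N × N => w.1 • w.2.1 + star w.2.2.1 * w.2.2.2 := by
      fun_prop
    refine map_mem_closure (s := Set.range r ×ˢ U ×ˢ U ×ˢ U) (x := (c, x, y, z)) hf ?_ ?_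
    · simp only [closure_prod_eq, Set.mem_prod]
      exact ⟨hr c, hx, hy, hz⟩
    · rintro ⟨_, x, y, z⟩ ⟨⟨k, rfl⟩, hx, hy, hz⟩
      exact hU k x hx y hy z hz
  have h0' := subset_closure h0
  have h1' := subset_closure h1
  have hstar (x : N) (hx : x ∈ closure U) : star x ∈ closure U := by
    simpa using key 0 0 x 1 h0' hx h1'
  exact ⟨{
    carrier := closure U
    mul_mem' := fun {x y} hx hy => by simpa using key 0 0 (star x) y h0' (hstar x hx) hy
    one_mem' := h1'
    add_mem' := fun {x y} hx hy => by simpa using key 1 x 1 y hx h1' hy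
    zero_mem' := h0'
    algebraMap_mem' := fun c => by
      simpa [Algebra.algebraMap_eq_smul_one] using key c 1 0 0 h1' h0' h0'
    star_mem' := fun {x} hx => hstar x hx }, rfl⟩

section CStarAlgebra

variable {M : Type*} [CStarAlgebra M]

theorem CStarAlgebra.mul_eq_self_of_star_mul_self_eq {s p : M} (hp : IsStarProjection p)
    (hs : star s * s = p) : s * p = s := by
  have hpp := hp.isIdempotentElem.eq
  rw [← sub_eq_zero, ← CStarRing.star_mul_self_eq_zero_iff]
  simp only [star_sub, star_mul, hp.isSelfAdjoint.star_eq, mul_sub, sub_mul]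
  simp only [← mul_assoc, mul_assoc p (star s) s, hs, hpp, sub_self]

/-- If `star y * y` is at distance less than one from a projection `p` with `y * p = y`, then
some right multiple of `y` is a partial isometry with initial projection `p`. -/
theorem CStarAlgebra.exists_star_mul_self_eq_of_norm_sub_lt_one {y p : M}
    (hp : IsStarProjection p) (hy : y * p = y) (h : ‖star y * y - p‖ < 1) :
    ∃ c : M, star (y * c) * (y * c) = p := by
  set a : M := star y * y + 1 - p with ha
  have hsa : IsSelfAdjoint a := by
    simp [ha, isSelfAdjoint_iff, hp.isSelfAdjoint.star_eq]
  have hpy : p * star y = star y := by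
    simpa [hp.isSelfAdjoint.star_eq] using congr_arg star hy
  have hap : a * p = star y * y := by
    rw [ha, sub_mul, add_mul, mul_assoc, hy, hp.isIdempotentElem.eq, one_mul, add_sub_cancel_right]
  have hpa : p * a = star y * y := by
    rw [ha, mul_sub, mul_add, ← mul_assoc, hpy, hp.isIdempotentElem.eq, mul_one,
      add_sub_cancel_right]
  have hspec (t : ℝ) (ht : t ∈ spectrum ℝ a) : 0 < t := by
    have h1 : t - 1 ∈ spectrum ℝ (a - 1) := by
      have := spectrum.sub_singleton_eq a (1 : ℝ)
      rw [map_one] at this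
      rw [← this]
      exact Set.sub_mem_sub ht rfl
    have h2 := spectrum.norm_le_norm_mul_of_mem h1
    have h3 : a - 1 = star y * y - p := by rw [ha]; abel
    have h4 : ‖(1 : M)‖ ≤ 1 := (IsStarProjection.one M).norm_le
    rw [h3, Real.norm_eq_abs] at h2
    have h5 := mul_le_of_le_one_right (norm_nonneg (star y * y - p)) h4
    linarith [neg_abs_le (t - 1)]
  let g : ℝ → ℝ := fun t => (√t)⁻¹
  have hg : ContinuousOn g (spectrum ℝ a) :=
    Real.continuous_sqrt.continuousOn.inv₀ fun t ht => (Real.sqrt_pos.mpr (hspec t ht)).ne'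
  set c : M := cfc g a with hc
  have hcsa : star c = c := (cfc_predicate g a : IsSelfAdjoint c).star_eq
  have hcac : c * a * c = 1 := by
    have hca : c * a = cfc (fun t => g t * t) a := by
      rw [cfc_mul g (fun t => t) a hg, cfc_id' ℝ a]
    rw [hca, hc, ← cfc_mul (fun t => g t * t) g a (hg.mul continuousOn_id) hg, ← cfc_one ℝ a]
    refine cfc_congr fun t ht => ?_
    have hpos := Real.sqrt_pos.mpr (hspec t ht)
    have hsq := Real.mul_self_sqrt (hspec t ht).le
    simp only [g, Pi.one_apply]
    field_simp
    rw [pow_two, hsq]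
  have hcomm : Commute c p := Commute.cfc_real (show Commute a p from hap.trans hpa.symm) g
  refine ⟨c, ?_⟩
  rw [star_mul, hcsa]
  calc c * star y * (y * c) = c * (star y * y) * c := by simp only [mul_assoc]
    _ = c * a * (p * c) := by rw [← hap]; simp only [mul_assoc]
    _ = c * a * c * p := by rw [← hcomm.eq]; simp only [mul_assoc]
    _ = p := by rw [hcac, one_mul]

/-- `x` implements the subequivalence of `a` to `b` up to an error `ε`. -/
def IsApproxSubequiv (ε : ℝ) (a b x : M) : Prop :=
  ‖x‖ ≤ 1 ∧ ‖star x * x - a‖ < ε ∧ ‖b * x - x‖ < ε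

theorem IsApproxSubequiv.of_norm_sub_lt {ε : ℝ} {p q a b s : M} (hp : IsStarProjection p)
    (hs : star s * s = p) (hqs : q * s = s) (ha : ‖p - a‖ < ε) (hb : ‖q - b‖ < ε) :
    IsApproxSubequiv ε a b s := by
  have hs1 : ‖s‖ ≤ 1 := by
    have h := CStarRing.norm_star_mul_self (x := s)
    rw [hs] at h
    nlinarith [norm_nonneg s, hp.norm_le]
  refine ⟨hs1, hs ▸ ha, ?_⟩
  calc ‖b * s - s‖ = ‖(q - b) * s‖ := by rw [sub_mul, hqs, norm_sub_rev]
    _ ≤ ‖q - b‖ * ‖s‖ := norm_mul_le _ _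
    _ ≤ ‖q - b‖ := mul_le_of_le_one_right (norm_nonneg _) hs1
    _ < ε := hb

theorem IsApproxSubequiv.norm_star_mul_self_sub_lt {ε : ℝ} {p q a b x : M}
    (hx : IsApproxSubequiv ε a b x) (hp : IsStarProjection p) (hq : IsStarProjection q)
    (ha : ‖p - a‖ < ε) (hb : ‖q - b‖ < ε) :
    ‖star (q * x * p) * (q * x * p) - p‖ < 4 * ε := by
  obtain ⟨hx1, hxa, hbx⟩ := hx
  have hpp := hp.norm_le
  have hqx : ‖q * x - x‖ < 2 * ε := by
    have h1 : ‖(q - b) * x‖ ≤ ‖q - b‖ :=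
      (norm_mul_le _ _).trans (mul_le_of_le_one_right (norm_nonneg _) hx1)
    have h2 : q * x - x = (q - b) * x + (b * x - x) := by noncomm_ring
    rw [h2]
    linarith [norm_add_le ((q - b) * x) (b * x - x)]
  have hmid : ‖star x * (q * x - x) + (star x * x - a) - (p - a)‖ < 4 * ε := by
    have h1 : ‖star x * (q * x - x)‖ ≤ ‖q * x - x‖ :=
      (norm_mul_le _ _).trans (mul_le_of_le_one_left (norm_nonneg _) (by rwa [norm_star]))
    linarith [norm_sub_le (star x * (q * x - x) + (star x * x - a)) (p - a),
      norm_add_le (star x * (q * x - x)) (star x * x - a)]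
  have heq : star (q * x * p) * (q * x * p) - p =
      p * (star x * (q * x - x) + (star x * x - a) - (p - a)) * p := by
    have hqq : q * (q * (x * p)) = q * (x * p) := by rw [← mul_assoc, hq.isIdempotentElem.eq]
    simp only [star_mul, hp.isSelfAdjoint.star_eq, hq.isSelfAdjoint.star_eq, mul_assoc, hqq,
      mul_sub, sub_mul, mul_add, add_mul, hp.isIdempotentElem.eq]
    abel
  rw [heq]
  refine lt_of_le_of_lt ((norm_mul_le _ _).trans (mul_le_of_le_one_right (norm_nonneg _) hpp)) ?_
  exact lt_of_le_of_lt ((norm_mul_le _ _).trans (mul_le_of_le_one_left (norm_nonneg _) hpp)) hmid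

end CStarAlgebra

section CStarMatrix

variable {N : Type*} [CStarAlgebra N] [PartialOrder N] [StarOrderedRing N]

/-- A countable subset of `N` is contained in a countable set that is stable under the operations
`(x, y, z) ↦ r k • x + star y * z` and in which approximate subequivalences of matrices are
implemented whenever they are implemented in `N`. -/
theorem CStarMatrix.exists_countable_superset_isApproxSubequiv (r : ℕ → ℂ) (ε : ℝ) {S : Set N}
    (hS : S.Countable) :
    ∃ U : Set N, U.Countable ∧ S ⊆ U ∧
      (∀ k, ∀ x ∈ U, ∀ y ∈ U, ∀ z ∈ U, r k • x + star y * z ∈ U) ∧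
      ∀ (m : ℕ) (a b : CStarMatrix (Fin m) (Fin m) N), (∀ i j, a i j ∈ U) → (∀ i j, b i j ∈ U) →
        (∃ x, IsApproxSubequiv ε a b x) → ∃ x, IsApproxSubequiv ε a b x ∧ ∀ i j, x i j ∈ U := by
  let α : ℕ ⊕ (Σ m : ℕ, Fin m × Fin m) → Type :=
    Sum.elim (fun _ => Fin 3) (fun i => Fin 2 × Fin i.1 × Fin i.1)
  have hα (i) : Finite (α i) := by
    rcases i with k | i
    · exact inferInstanceAs (Finite (Fin 3))
    · exact inferInstanceAs (Finite (Fin 2 × Fin i.1 × Fin i.1))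
  let W (m : ℕ) (a b : CStarMatrix (Fin m) (Fin m) N) : CStarMatrix (Fin m) (Fin m) N :=
    Classical.epsilon (IsApproxSubequiv ε a b)
  let F : ∀ i, (α i → N) → N := fun i => match i with
    | .inl k => fun v : Fin 3 → N => r k • v 0 + star (v 1) * v 2
    | .inr ⟨m, i, j⟩ => fun v : Fin 2 × Fin m × Fin m → N =>
      W m (.ofMatrix fun i j => v (0, i, j)) (.ofMatrix fun i j => v (1, i, j)) i j
  obtain ⟨U, hU, hSU, hF⟩ := hS.exists_superset_closed_under F
  refine ⟨U, hU, hSU, fun k x hx y hy z hz => ?_, fun m a b ha hb h => ?_⟩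
  · refine hF (.inl k) ![x, y, z] fun j : Fin 3 => ?_
    fin_cases j <;> assumption
  · refine ⟨W m a b, Classical.epsilon_spec h, fun i j => ?_⟩
    refine hF (.inr ⟨m, i, j⟩) (fun w : Fin 2 × Fin m × Fin m => ![a, b] w.1 w.2.1 w.2.2) ?_
    rintro ⟨l, i, j⟩
    fin_cases l
    · exact ha i j
    · exact hb i j

/-- A matrix with entries in the closure of `U` is approximated by matrices with entries in `U`. -/
theorem CStarMatrix.exists_norm_sub_lt_of_forall_mem_closure {n : Type*} [Fintype n]
    [DecidableEq n] {U : Set N} {p : CStarMatrix n n N} (hp : ∀ i j, p i j ∈ closure U) {ε : ℝ}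
    (hε : 0 < ε) : ∃ a : CStarMatrix n n N, (∀ i j, a i j ∈ U) ∧ ‖p - a‖ < ε := by
  let V : Set (n → n → N) := Set.univ.pi fun _ => Set.univ.pi fun _ => U
  have hpV : p ∈ closure (X := CStarMatrix n n N) V := by
    change (p : n → n → N) ∈ closure V
    simp only [V, closure_pi_set]
    exact fun i _ j _ => hp i j
  obtain ⟨a, haV, ha⟩ := Metric.mem_closure_iff.mp hpV ε hε
  exact ⟨a, fun i j => haV i trivial j trivial, by rwa [← dist_eq_norm]⟩

end CStarMatrix


/-- Given a unital C*-algebra `N` and a separable C*-subalgebra `A ⊆ N` containing the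
unit, there is a separable C*-subalgebra `B` with `A ⊆ B ⊆ N` and `1 ∈ B` such that any
two projections `p, q` of a matrix algebra `M_m(B)` with `p` Murray–von Neumann
subequivalent to `q` in `M_m(N)` satisfy `p` Murray–von Neumann subequivalent to `q` in
`M_m(B)`.  (For projections `e` and `q`, the relation `e ≤ q` is expressed by
`q * e = e`.) -/
theorem exists_separable_intermediate_subalgebra_mvN_subequiv
    (N : Type*) [CStarAlgebra N]
    (A : StarSubalgebra ℂ N) (hA_closed : IsClosed (A : Set N))
    (hA_sep : TopologicalSpace.SeparableSpace A) :
    ∃ B : StarSubalgebra ℂ N, IsClosed (B : Set N) ∧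
      TopologicalSpace.SeparableSpace B ∧ A ≤ B ∧ (1 : N) ∈ B ∧
      ∀ (m : ℕ), 0 < m →
        ∀ p q : Matrix (Fin m) (Fin m) B,
          star p = p → p * p = p → star q = q → q * q = q →
          (∃ (s e : Matrix (Fin m) (Fin m) N),
            star e = e ∧ e * e = e ∧ q.map ((↑) : B → N) * e = e ∧
            star s * s = p.map ((↑) : B → N) ∧ s * star s = e) →
          ∃ (t f : Matrix (Fin m) (Fin m) B),
            star f = f ∧ f * f = f ∧ q * f = f ∧
            star t * t = p ∧ t * star t = f := by
  let _ := CStarAlgebra.spectralOrder N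
  let _ := CStarAlgebra.spectralOrderedRing N
  obtain ⟨S, hS, hS_dense⟩ := TopologicalSpace.exists_countable_dense A
  obtain ⟨U, hU, hSU, hU_op, hU_mat⟩ :=
    CStarMatrix.exists_countable_superset_isApproxSubequiv (TopologicalSpace.denseSeq ℂ) (1 / 16)
      (((hS.image ((↑) : A → N)).insert 1).insert 0)
  obtain ⟨B, hB⟩ := StarSubalgebra.exists_coe_eq_closure_s8 (TopologicalSpace.denseRange_denseSeq ℂ)
    (hSU (Set.mem_insert _ _)) (hSU (Set.mem_insert_of_mem _ (Set.mem_insert _ _))) hU_op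
  have hB_mem (x : N) : x ∈ B ↔ x ∈ closure U := by rw [← hB, SetLike.mem_coe]
  have hB_closed : IsClosed (B : Set N) := hB ▸ isClosed_closure
  refine ⟨B, hB_closed, ?_, fun x hx => ?_, one_mem B, ?_⟩
  · exact (hB ▸ hU.isSeparable.closure : TopologicalSpace.IsSeparable (B : Set N)).separableSpace
  · rw [hB_mem]
    exact map_mem_closure continuous_subtype_val (hS_dense ⟨x, hx⟩) fun y hy =>
      hSU (Set.mem_insert_of_mem _ (Set.mem_insert_of_mem _ (Set.mem_image_of_mem _ hy)))
  rintro m - p q hp hpp hq hqq ⟨s, e, -, -, hqe, hsp, hse⟩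
  let _ := CStarAlgebra.spectralOrder B
  let _ := CStarAlgebra.spectralOrderedRing B
  let φ : CStarMatrix (Fin m) (Fin m) B →⋆ₙₐ[ℂ] CStarMatrix (Fin m) (Fin m) N :=
    CStarMatrix.mapₙₐ (B.subtype : B →⋆ₙₐ[ℂ] N)
  have hφ : Function.Injective φ := fun a b h => by
    ext i j
    exact congr_fun (congr_fun h i) j
  let P : CStarMatrix (Fin m) (Fin m) B := .ofMatrix p
  let Q : CStarMatrix (Fin m) (Fin m) B := .ofMatrix q
  let s' : CStarMatrix (Fin m) (Fin m) N := .ofMatrix s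
  have hP : IsStarProjection P := ⟨hpp, hp⟩
  have hQ : IsStarProjection Q := ⟨hqq, hq⟩
  have hsP : star s' * s' = φ P := hsp
  have hφP : IsStarProjection (φ P) := hP.map φ
  have hφQ : IsStarProjection (φ Q) := hQ.map φ
  have hQs : φ Q * s' = s' := by
    have hss : s' * star s' = .ofMatrix e := hse
    have h : φ Q * (s' * star s') = s' * star s' := by
      rw [hss]
      exact hqe
    rw [← CStarAlgebra.mul_eq_self_of_star_mul_self_eq hφP hsP, ← hsP, ← mul_assoc s', ← mul_assoc,
      h]
  obtain ⟨a, haU, ha⟩ := CStarMatrix.exists_norm_sub_lt_of_forall_mem_closure (U := U) (p := φ P)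
    (fun i j => (hB_mem _).mp (p i j).2) (ε := 1 / 16) (by norm_num)
  obtain ⟨b, hbU, hb⟩ := CStarMatrix.exists_norm_sub_lt_of_forall_mem_closure (U := U) (p := φ Q)
    (fun i j => (hB_mem _).mp (q i j).2) (ε := 1 / 16) (by norm_num)
  obtain ⟨x, hx, hxU⟩ := hU_mat m a b haU hbU ⟨s', .of_norm_sub_lt hφP hsP hQs ha hb⟩
  let X : CStarMatrix (Fin m) (Fin m) B :=
    .ofMatrix fun i j => ⟨x i j, (hB_mem _).mpr (subset_closure (hxU i j))⟩
  have hX : φ X = x := rfl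
  have hnorm : ‖star (Q * X * P) * (Q * X * P) - P‖ < 1 := by
    rw [← NonUnitalStarAlgHom.norm_map φ hφ]
    have := hx.norm_star_mul_self_sub_lt hφP hφQ ha hb
    simp only [map_sub, map_mul, map_star, hX]
    linarith
  obtain ⟨c, hc⟩ := CStarAlgebra.exists_star_mul_self_eq_of_norm_sub_lt_one hP
    (by rw [mul_assoc, hP.isIdempotentElem.eq]) hnorm
  let T := Q * X * P * c
  have hQT : Q * T = T := by
    simp only [T, ← mul_assoc, hQ.isIdempotentElem.eq]
  have hTT : T * star T * (T * star T) = T * star T := by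
    rw [mul_assoc, ← mul_assoc (star T), hc, ← mul_assoc,
      CStarAlgebra.mul_eq_self_of_star_mul_self_eq hP hc]
  have hQTT : Q * (T * star T) = T * star T := by rw [← mul_assoc, hQT]
  exact ⟨T, T * star T, (IsSelfAdjoint.mul_star_self T).star_eq, hTT, hQTT, hc, rfl⟩
end
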